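/- arXiv:1304.2250 — 2 statements merged into one kernel-verified Lean document; each statement's English description precedes it below -/
import Mathlib

section
/- Let n ≥ 1 and fix positive parameters τ₀, d₀, ρ, δ, μ and d₁. There exists θ ∈ (0,1), depending only on n, τ₀, d₀, ρ, δ, μ and d₁, such that the following holds. Let D ⊂ ℝⁿ be an open, bounded and connected set with diam D ≤ d₁ such that {x ∈ D : dist(x, ∂D) > τ} is connected for every τ ∈ [0, τ₀]. Let E ⊂ D be an open set with dist(E, ∂D) ≥ d₀ and vol(E)/vol(D) ≥ μ (Lebesgue measure). Let M > 0 and let f : ℝⁿ → ℝ be real-analytic on D with ‖(iterated Fréchet derivative) D^m f (x)‖ ≤ M · m! / ρ^m for all x ∈ D and all m ∈ ℕ. Then for every x ∈ D with dist(x, ∂D) ≥ δ one has |f(x)| ≤ (2M)^{1−θ} · (sup_{y ∈ E} |f(y)|)^{θ}. -/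
open MeasureTheory Metric

/-- The product of a finite set of positive naturals is at least the factorial of its size. -/
lemma factorial_card_le_prod (s : Finset ℕ) (hs : ∀ x ∈ s, 0 < x) :
    s.card.factorial ≤ ∏ x ∈ s, x := by
  induction s using Finset.induction_on_max with
  | empty => simp
  | insert a s hlt ih =>
    have ha : a ∉ s := fun h => (hlt a h).false
    rw [Finset.prod_insert ha, Finset.card_insert_of_notMem ha, Nat.factorial_succ]
    have hsub : s ⊆ Finset.Ioo 0 a := fun x hx =>
      Finset.mem_Ioo.2 ⟨hs x (Finset.mem_insert_of_mem hx), hlt x hx⟩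
    have hcard := Finset.card_le_card hsub
    have hpos := hs a (Finset.mem_insert_self a s)
    rw [Nat.card_Ioo] at hcard
    exact Nat.mul_le_mul (by omega) (ih fun x hx => hs x (Finset.mem_insert_of_mem hx))

lemma factorial_card_le_prod_of_injOn {ι : Type*} (s : Finset ι) (g : ι → ℕ)
    (hg : Set.InjOn g s) (hpos : ∀ x ∈ s, 0 < g x) :
    s.card.factorial ≤ ∏ x ∈ s, g x := by
  classical
  have h := factorial_card_le_prod (s.image g) (by simpa using hpos)
  rwa [Finset.card_image_of_injOn hg, Finset.prod_image hg] at h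

/-- The product of the distances from one point of a finite set of integers to all the others. -/
lemma factorial_le_two_pow_mul_prod_abs_sub (A : Finset ℕ) (i : ℕ) (hi : i ∈ A) :
    ((A.card - 1).factorial : ℝ) ≤
      2 ^ (A.card - 1) * ∏ j ∈ A.erase i, |(i : ℝ) - j| := by
  have hfilter : (A.erase i).filter (fun j => ¬ j < i) = (A.erase i).filter (fun j => i < j) := by
    refine Finset.filter_congr fun j hj => ?_
    have := (Finset.mem_erase.1 hj).1
    omega
  have hcard : ((A.erase i).filter (fun j => j < i)).card +
      ((A.erase i).filter (fun j => i < j)).card = A.card - 1 := by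
    rw [← hfilter, Finset.card_filter_add_card_filter_not, Finset.card_erase_of_mem hi]
  have hlow := factorial_card_le_prod_of_injOn ((A.erase i).filter (fun j => j < i))
    (fun j => i - j)
    (by intro x hx y hy h; simp at hx hy h; omega) (by intro x hx; simp at hx; omega)
  have hhigh := factorial_card_le_prod_of_injOn ((A.erase i).filter (fun j => i < j))
    (fun j => j - i)
    (by intro x hx y hy h; simp at hx hy h; omega) (by intro x hx; simp at hx; omega)
  rw [← Finset.prod_filter_mul_prod_filter_not (A.erase i) (fun j => j < i), hfilter]
  have hlow' : ∏ j ∈ (A.erase i).filter (fun j => j < i), |(i : ℝ) - j| =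
      ((∏ j ∈ (A.erase i).filter (fun j => j < i), (i - j) : ℕ) : ℝ) := by
    push_cast
    refine Finset.prod_congr rfl fun j hj => ?_
    have h := (Finset.mem_filter.1 hj).2
    rw [Nat.cast_sub h.le, abs_of_pos (sub_pos.2 (by exact_mod_cast h))]
  have hhigh' : ∏ j ∈ (A.erase i).filter (fun j => i < j), |(i : ℝ) - j| =
      ((∏ j ∈ (A.erase i).filter (fun j => i < j), (j - i) : ℕ) : ℝ) := by
    push_cast
    refine Finset.prod_congr rfl fun j hj => ?_
    have h := (Finset.mem_filter.1 hj).2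
    rw [Nat.cast_sub h.le, abs_sub_comm, abs_of_pos (sub_pos.2 (by exact_mod_cast h))]
  rw [hlow', hhigh']
  norm_cast
  set a := ((A.erase i).filter (fun j => j < i)).card
  set b := ((A.erase i).filter (fun j => i < j)).card
  rw [← hcard, ← Nat.add_choose_mul_factorial_mul_factorial a b, mul_assoc]
  exact Nat.mul_le_mul (Nat.choose_le_two_pow _ _) (Nat.mul_le_mul hlow hhigh)

/-- A Remez-type inequality: extrapolation to `0` of a polynomial bounded on part of a uniform grid
of `[1/2, 1)`. -/
lemma abs_eval_zero_le_of_abs_eval_grid_le (p : Polynomial ℝ) (N : ℕ) (A : Finset ℕ)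
    (hA : A ⊆ Finset.range N) (hne : A.Nonempty) (hp : p.degree < A.card) (η : ℝ)
    (hη : ∀ i ∈ A, |p.eval (1 / 2 + i / (2 * N) : ℝ)| ≤ η) :
    |p.eval 0| ≤
      A.card * ((4 * N) ^ (A.card - 1) / (A.card - 1).factorial) * η := by
  obtain ⟨i₀, hi₀⟩ := hne
  have hη0 : 0 ≤ η := (abs_nonneg _).trans (hη i₀ hi₀)
  have hN : (0 : ℝ) < N := by
    have := Finset.mem_range.1 (hA hi₀)
    exact_mod_cast (by omega : 0 < N)
  set v : ℕ → ℝ := fun i => 1 / 2 + i / (2 * N) with hv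
  have hsub : ∀ i j : ℕ, v i - v j = ((i : ℝ) - j) / (2 * N) := by
    intro i j; simp only [hv]; ring
  have hinj : Set.InjOn v A := by
    intro i _ j _ h
    have h0 := hsub i j
    rw [h, sub_self, eq_comm, div_eq_zero_iff] at h0
    rcases h0 with h0 | h0
    · exact_mod_cast sub_eq_zero.1 h0
    · linarith
  have hbasis : ∀ i ∈ A, |(Lagrange.basis A v i).eval 0| ≤
      (4 * N) ^ (A.card - 1) / (A.card - 1).factorial := by
    intro i hi
    have hprodpos : 0 < ∏ j ∈ A.erase i, |(i : ℝ) - j| := by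
      refine Finset.prod_pos fun j hj => abs_pos.2 (sub_ne_zero.2 ?_)
      exact_mod_cast (Finset.mem_erase.1 hj).1.symm
    calc |(Lagrange.basis A v i).eval 0|
        = ∏ j ∈ A.erase i, |v j| * (2 * N) / |(i : ℝ) - j| := by
          rw [Lagrange.basis, Polynomial.eval_prod, Finset.abs_prod]
          refine Finset.prod_congr rfl fun j hj => ?_
          simp only [Lagrange.basisDivisor, Polynomial.eval_mul, Polynomial.eval_C,
            Polynomial.eval_sub, Polynomial.eval_X, hsub, abs_mul, zero_sub, abs_neg, abs_inv,
            abs_div]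
          rw [abs_of_pos hN, abs_two]
          field_simp
      _ ≤ ∏ j ∈ A.erase i, (2 * N) / |(i : ℝ) - j| := by
          refine Finset.prod_le_prod (fun j _ => by positivity) fun j hj => ?_
          have hj' : (j : ℝ) < N := by
            exact_mod_cast Finset.mem_range.1 (hA (Finset.mem_of_mem_erase hj))
          have hvj : |v j| ≤ 1 := by
            have hvn : 0 ≤ v j := by simp only [hv]; positivity
            rw [abs_of_nonneg hvn]
            have : (j : ℝ) / (2 * N) ≤ 1 / 2 := by
              rw [div_le_iff₀ (by positivity)]; linarith
            simp only [hv]; linarith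
          exact div_le_div_of_nonneg_right (mul_le_of_le_one_left (by positivity) hvj)
            (abs_nonneg _)
      _ = (2 * N) ^ (A.card - 1) / ∏ j ∈ A.erase i, |(i : ℝ) - j| := by
          rw [Finset.prod_div_distrib, Finset.prod_const, Finset.card_erase_of_mem hi]
      _ ≤ (4 * N) ^ (A.card - 1) / (A.card - 1).factorial := by
          rw [div_le_div_iff₀ hprodpos (by positivity)]
          calc (2 * (N : ℝ)) ^ (A.card - 1) * (A.card - 1).factorial
              ≤ (2 * N) ^ (A.card - 1) *
                (2 ^ (A.card - 1) * ∏ j ∈ A.erase i, |(i : ℝ) - j|) := by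
                gcongr
                exact factorial_le_two_pow_mul_prod_abs_sub A i hi
            _ = (4 * N) ^ (A.card - 1) * ∏ j ∈ A.erase i, |(i : ℝ) - j| := by
                rw [← mul_assoc, ← mul_pow]; ring_nf
  rw [Lagrange.eq_interpolate hinj hp, Lagrange.interpolate_apply, Polynomial.eval_finsetSum]
  calc |∑ i ∈ A, (Polynomial.C (p.eval (v i)) * Lagrange.basis A v i).eval 0|
      ≤ ∑ i ∈ A, |(Polynomial.C (p.eval (v i)) * Lagrange.basis A v i).eval 0| :=
        Finset.abs_sum_le_sum_abs _ _
    _ ≤ ∑ i ∈ A, η * ((4 * N) ^ (A.card - 1) / (A.card - 1).factorial) := by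
        refine Finset.sum_le_sum fun i hi => ?_
        rw [Polynomial.eval_mul, Polynomial.eval_C, abs_mul]
        exact mul_le_mul (hη i hi) (hbasis i hi) (abs_nonneg _) hη0
    _ = _ := by rw [Finset.sum_const, nsmul_eq_mul]; ring

/-- The extrapolation constant for a grid of size comparable to the degree grows geometrically. -/
lemma extrapolation_const_le (c : ℝ) (hc : 0 < c) (hc1 : c ≤ 1) (k : ℕ) (hk : 1 ≤ k) (N : ℝ)
    (hN0 : 0 ≤ N) (hN : N ≤ 2 * k / c) :
    k * ((4 * N) ^ (k - 1) / (k - 1).factorial) ≤ (48 / c) ^ k := by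
  obtain ⟨m, rfl⟩ : ∃ m, k = m + 1 := ⟨k - 1, by omega⟩
  simp only [Nat.add_sub_cancel]
  push_cast at hN ⊢
  have hm : (0 : ℝ) < m + 1 := by positivity
  have hexp : ((m : ℝ) + 1) ^ (m + 1) / (m + 1).factorial ≤ 3 ^ (m + 1) := by
    refine (Real.pow_div_factorial_le_exp _ hm.le (m + 1)).trans ?_
    have h : Real.exp ((m : ℝ) + 1) = Real.exp 1 ^ (m + 1) := by
      rw [← Real.exp_nat_mul]; push_cast; ring_nf
    rw [h]
    gcongr
    linarith [Real.exp_one_lt_d9]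
  have htwo : (m : ℝ) + 1 ≤ 2 ^ (m + 1) := by
    exact_mod_cast (Nat.lt_two_pow_self (n := m + 1)).le
  have h8 : 1 ≤ 8 / c := by rw [le_div_iff₀ hc]; linarith
  calc ((m : ℝ) + 1) * ((4 * N) ^ m / m.factorial)
      ≤ (m + 1) * ((4 * (2 * (m + 1) / c)) ^ m / m.factorial) := by gcongr
    _ = (m + 1) * (8 / c) ^ m * (((m : ℝ) + 1) ^ (m + 1) / (m + 1).factorial) := by
        rw [Nat.factorial_succ]
        push_cast
        rw [show 4 * (2 * ((m : ℝ) + 1) / c) = 8 / c * (m + 1) by ring, mul_pow]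
        field_simp
        ring
    _ ≤ 2 ^ (m + 1) * (8 / c) ^ (m + 1) * 3 ^ (m + 1) := by
        gcongr
        omega
    _ = (48 / c) ^ (m + 1) := by
        rw [← mul_pow, ← mul_pow]; ring_nf

/-- Hölder bound from a family of bounds with competing geometric terms. -/
lemma exists_rpow_bound_of_geometric_bounds (C : ℝ) (hC : 1 ≤ C) :
    ∃ θ ∈ Set.Ioo (0 : ℝ) 1, ∀ u h : ℝ, u ≤ 1 / 2 → 0 ≤ h →
      (∀ k : ℕ, 1 ≤ k → u ≤ C ^ k * h + (1 / 2) ^ k / 2) → u ≤ h ^ θ := by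
  set K := 2 * C with hK
  have hK2 : 2 ≤ K := by linarith
  have hlog2 : 0 < Real.log 2 := Real.log_pos (by norm_num)
  have hlogK : Real.log 2 ≤ Real.log K := Real.log_le_log (by norm_num) hK2
  have hlogK0 : 0 < Real.log K := hlog2.trans_le hlogK
  have hθ1 : Real.log 2 / (3 * Real.log K) < 1 := by
    rw [div_lt_one (by positivity)]; linarith
  refine ⟨Real.log 2 / (3 * Real.log K), ⟨by positivity, hθ1⟩, ?_⟩
  intro u h hu hh0 hb
  have hθ : 0 < Real.log 2 / (3 * Real.log K) := by positivity
  rcases lt_or_ge (1 / 2) h with hh | hh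
  · calc u ≤ 1 / 2 := hu
      _ = (1 / 2 : ℝ) ^ (1 : ℝ) := (Real.rpow_one _).symm
      _ ≤ (1 / 2 : ℝ) ^ (Real.log 2 / (3 * Real.log K)) :=
        Real.rpow_le_rpow_of_exponent_ge (by norm_num) (by norm_num) hθ1.le
      _ ≤ _ := Real.rpow_le_rpow (by norm_num) hh.le hθ.le
  rcases hh0.eq_or_lt with rfl | hpos
  · rw [Real.zero_rpow hθ.ne']
    have htend : Filter.Tendsto (fun k : ℕ => (1 / 2 : ℝ) ^ k / 2) Filter.atTop (nhds 0) := by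
      simpa using (tendsto_pow_atTop_nhds_zero_of_lt_one (r := (1 / 2 : ℝ)) (by norm_num)
        (by norm_num)).div_const 2
    refine ge_of_tendsto htend ?_
    filter_upwards [Filter.eventually_ge_atTop 1] with k hk
    simpa using hb k hk
  · obtain ⟨k, hk1, hk2⟩ := exists_nat_pow_near (x := 1 / (2 * h)) (y := K)
      (by rw [le_div_iff₀ (by positivity)]; linarith) (by linarith)
    rw [le_div_iff₀ (by positivity)] at hk1
    rw [div_lt_iff₀ (by positivity)] at hk2
    have hK0 : 0 < K := by linarith
    have hlow : Real.exp (-(k + 2) * Real.log K) ≤ h := by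
      rw [show -((k : ℝ) + 2) * Real.log K = -(((k + 2 : ℕ) : ℝ) * Real.log K) by push_cast; ring,
        Real.exp_neg, Real.exp_nat_mul, Real.exp_log hK0]
      refine inv_le_of_inv_le₀ hpos ?_
      rw [inv_le_iff_one_le_mul₀ hpos]
      calc (1 : ℝ) ≤ K ^ (k + 1) * (2 * h) := hk2.le
        _ ≤ K ^ (k + 1) * (K * h) := by gcongr
        _ = K ^ (k + 2) * h := by ring
    have hrpow : Real.exp (-((k : ℝ) + 2) / 3 * Real.log 2) ≤
        h ^ (Real.log 2 / (3 * Real.log K)) := by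
      calc Real.exp (-((k : ℝ) + 2) / 3 * Real.log 2)
          = Real.exp (-(k + 2) * Real.log K) ^ (Real.log 2 / (3 * Real.log K)) := by
            rw [← Real.exp_mul]; congr 1; field_simp
        _ ≤ _ := Real.rpow_le_rpow (Real.exp_pos _).le hlow hθ.le
    refine le_trans ?_ hrpow
    rcases Nat.eq_zero_or_pos k with rfl | hkpos
    · refine hu.trans ?_
      rw [show (1 / 2 : ℝ) = Real.exp (-Real.log 2) by
        rw [Real.exp_neg, Real.exp_log two_pos, one_div]]
      refine Real.exp_le_exp.2 ?_
      push_cast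
      linarith
    · have h2 : (1 / 2 : ℝ) ^ k = Real.exp (-k * Real.log 2) := by
        rw [neg_mul, Real.exp_neg, Real.exp_nat_mul, Real.exp_log two_pos, one_div, inv_pow]
      have hCk : C ^ k * h ≤ (1 / 2) ^ k / 2 := by
        rw [hK, mul_pow] at hk1
        rw [one_div, inv_pow, inv_eq_one_div, div_div, le_div_iff₀ (by positivity)]
        linarith
      have hk1' : (1 : ℝ) ≤ k := by exact_mod_cast hkpos
      calc u ≤ (1 / 2) ^ k := by linarith [hb k hkpos]
        _ ≤ _ := by
          rw [h2]
          refine Real.exp_le_exp.2 (mul_le_mul_of_nonneg_right ?_ hlog2.le)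
          linarith

section Extrapolation

variable {V : Type*} [NormedAddCommGroup V] [NormedSpace ℝ V]

/-- Taylor expansion along a segment with a remainder bound from analytic-type derivative
estimates. -/
lemma abs_sub_taylor_le {f : V → ℝ} {x y : V} {M ρ : ℝ} {k : ℕ}
    (hk : 1 ≤ k) (hf : ∀ t ∈ Set.Icc (0 : ℝ) 1, AnalyticAt ℝ f (x + t • y))
    (hb : ∀ t ∈ Set.Icc (0 : ℝ) 1,
      ‖iteratedFDeriv ℝ k f (x + t • y)‖ ≤ M * k.factorial / ρ ^ k) :
    |f (x + y) - ∑ j ∈ Finset.range k,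
      (j.factorial : ℝ)⁻¹ * iteratedFDeriv ℝ j f x (fun _ => y)| ≤ M * k * (‖y‖ / ρ) ^ k := by
  obtain ⟨m, rfl⟩ : ∃ m, k = m + 1 := ⟨k - 1, by omega⟩
  rw [map_add_eq_sum_add_integral_iteratedFDeriv (n := m)
    (fun t ht => (hf t ht).contDiffAt)]
  simp only [smul_eq_mul, add_sub_cancel_left]
  have hint : ‖∫ t in (0 : ℝ)..1, (1 - t) ^ m * iteratedFDeriv ℝ (m + 1) f (x + t • y)
      (fun _ => y)‖ ≤ (M * (m + 1).factorial / ρ ^ (m + 1) * ‖y‖ ^ (m + 1)) * |1 - 0| := by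
    refine intervalIntegral.norm_integral_le_of_norm_le_const fun t ht => ?_
    rw [Set.uIoc_of_le zero_le_one] at ht
    rw [norm_mul, Real.norm_of_nonneg (pow_nonneg (by linarith [ht.2]) m)]
    have h1 : (1 - t) ^ m ≤ 1 := pow_le_one₀ (by linarith [ht.2]) (by linarith [ht.1])
    refine (mul_le_of_le_one_left (norm_nonneg _) h1).trans ?_
    refine (ContinuousMultilinearMap.le_opNorm _ _).trans ?_
    rw [Finset.prod_const, Finset.card_univ, Fintype.card_fin]
    gcongr
    exact hb t ⟨ht.1.le, ht.2⟩
  rw [Real.norm_eq_abs, sub_zero, abs_one, mul_one] at hint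
  rw [abs_mul, abs_inv, Nat.abs_cast]
  calc (m.factorial : ℝ)⁻¹ * |∫ t in (0 : ℝ)..1, (1 - t) ^ m *
        iteratedFDeriv ℝ (m + 1) f (x + t • y) (fun _ => y)|
      ≤ (m.factorial : ℝ)⁻¹ * (M * (m + 1).factorial / ρ ^ (m + 1) * ‖y‖ ^ (m + 1)) := by
        gcongr
    _ = M * (m + 1 : ℕ) * (‖y‖ / ρ) ^ (m + 1) := by
        rw [Nat.factorial_succ, div_pow]
        push_cast
        field_simp

/-- If finitely many subsets of `B` have total measure more than `m * μ B`, then some point lies in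
more than `m` of them. -/
lemma exists_lt_card_filter_mem {α : Type*} [MeasurableSpace α] (μ : Measure α) (B : Set α)
    (A : ℕ → Set α) (N m : ℕ) (hA : ∀ i, MeasurableSet (A i))
    (hAB : ∀ i ∈ Finset.range N, A i ⊆ B)
    (hlt : m * μ B < ∑ i ∈ Finset.range N, μ (A i)) :
    ∃ y : α, ∃ T ⊆ Finset.range N, T.card = m + 1 ∧ ∀ i ∈ T, y ∈ A i := by
  classical
  suffices h : ∃ y : α, m < ((Finset.range N).filter (fun i => y ∈ A i)).card by
    obtain ⟨y, hy⟩ := h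
    obtain ⟨T, hT, hcard⟩ := Finset.exists_subset_card_eq hy
    exact ⟨y, T, hT.trans (Finset.filter_subset _ _), hcard,
      fun i hi => (Finset.mem_filter.1 (hT hi)).2⟩
  by_contra! hcon
  refine hlt.not_ge ?_
  calc ∑ i ∈ Finset.range N, μ (A i)
      = ∑ i ∈ Finset.range N, ∫⁻ y in B, (A i).indicator 1 y ∂μ := by
        refine Finset.sum_congr rfl fun i hi => ?_
        rw [lintegral_indicator_one (hA i), Measure.restrict_apply (hA i),
          Set.inter_eq_left.2 (hAB i hi)]
    _ = ∫⁻ y in B, ∑ i ∈ Finset.range N, (A i).indicator 1 y ∂μ := by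
        rw [lintegral_finsetSum]
        exact fun i _ => measurable_one.indicator (hA i)
    _ ≤ ∫⁻ _ in B, (m : ENNReal) ∂μ := by
        refine lintegral_mono fun y => ?_
        simp only [Set.indicator_apply, Pi.one_apply, Finset.sum_boole]
        exact_mod_cast hcon y
    _ = m * μ B := by rw [setLIntegral_const]

variable [FiniteDimensional ℝ V] [MeasurableSpace V] [BorelSpace V]

/-- Many points of a uniform grid on some segment issued from `x` lie in a given set of positive
density. -/
lemma exists_segment_grid_mem (μ : Measure V) [μ.IsAddHaarMeasure] {x : V} {ℓ c : ℝ} (hℓ : 0 < ℓ)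
    {F : Set V} (hF : MeasurableSet F) (hFs : F ⊆ ball x (ℓ / 2))
    (hdens : ENNReal.ofReal c * μ (ball x ℓ) ≤ μ F) {k N : ℕ} (hk : 1 ≤ k)
    (hN : k ≤ N * c) :
    ∃ v : V, ‖v‖ < ℓ ∧ ∃ T ⊆ Finset.range N, T.card = k ∧
      ∀ i ∈ T, x + (1 / 2 + i / (2 * N) : ℝ) • v ∈ F := by
  set s : ℕ → ℝ := fun i => 1 / 2 + i / (2 * N) with hs
  have hspos : ∀ i, 1 / 2 ≤ s i := fun i => le_add_of_nonneg_right (by positivity)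
  set A : ℕ → Set V := fun i => (fun y => x + s i • (y - x)) ⁻¹' F with hA
  have hAmeas : ∀ i, MeasurableSet (A i) := fun i =>
    hF.preimage (by fun_prop : Continuous fun y : V => x + s i • (y - x)).measurable
  have hAB : ∀ i, A i ⊆ ball x ℓ := by
    intro i y hy
    have h := hFs hy
    rw [mem_ball, dist_eq_norm, add_sub_cancel_left, norm_smul,
      Real.norm_of_nonneg (by linarith [hspos i])] at h
    rw [mem_ball, dist_eq_norm]
    nlinarith [hspos i, norm_nonneg (y - x)]
  have hAvol : ∀ i ∈ Finset.range N, μ F ≤ μ (A i) := by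
    intro i hi
    have hiN : (i : ℝ) < N := by exact_mod_cast Finset.mem_range.1 hi
    have hs0 : 0 < s i := by linarith [hspos i]
    have hs1 : s i ≤ 1 := by
      have : (i : ℝ) / (2 * N) ≤ 1 / 2 := by
        rw [div_le_iff₀ (by linarith [(Nat.cast_nonneg i : (0 : ℝ) ≤ i)])]; linarith
      simp only [hs]; linarith
    have himage : AffineMap.homothety x (s i)⁻¹ '' F ⊆ A i := by
      rintro _ ⟨z, hz, rfl⟩
      simp only [hA, Set.mem_preimage, AffineMap.homothety_apply, vsub_eq_sub, vadd_eq_add,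
        add_sub_cancel_right]
      rwa [smul_inv_smul₀ hs0.ne', add_sub_cancel]
    refine le_trans ?_ (measure_mono himage)
    rw [Measure.addHaar_image_homothety]
    refine le_mul_of_one_le_left' ?_
    rw [ENNReal.one_le_ofReal]
    exact (one_le_pow₀ ((one_le_inv₀ hs0).2 hs1)).trans (le_abs_self _)
  have hB0 : μ (ball x ℓ) ≠ 0 := (measure_ball_pos μ x hℓ).ne'
  have hBtop : μ (ball x ℓ) ≠ ⊤ := measure_ball_lt_top.ne
  obtain ⟨m, rfl⟩ : ∃ m, k = m + 1 := ⟨k - 1, by omega⟩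
  obtain ⟨y, T, hT, hcard, hmem⟩ := exists_lt_card_filter_mem μ (ball x ℓ) A N m hAmeas
    (fun i _ => hAB i) <| by
    calc (m : ENNReal) * μ (ball x ℓ) < ((m + 1 : ℕ) : ENNReal) * μ (ball x ℓ) :=
          (ENNReal.mul_lt_mul_iff_left hB0 hBtop).2 (by exact_mod_cast Nat.lt_succ_self m)
      _ ≤ ENNReal.ofReal (N * c) * μ (ball x ℓ) := by
          gcongr
          rw [← ENNReal.ofReal_natCast]
          exact ENNReal.ofReal_le_ofReal hN
      _ = N * (ENNReal.ofReal c * μ (ball x ℓ)) := by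
          rw [ENNReal.ofReal_mul (Nat.cast_nonneg N), ENNReal.ofReal_natCast, mul_assoc]
      _ ≤ N * μ F := by gcongr
      _ = ∑ i ∈ Finset.range N, μ F := by rw [Finset.sum_const, Finset.card_range, nsmul_eq_mul]
      _ ≤ ∑ i ∈ Finset.range N, μ (A i) := Finset.sum_le_sum hAvol
  obtain ⟨i₀, hi₀⟩ := Finset.card_pos.1 (by omega : 0 < T.card)
  refine ⟨y - x, ?_, T, hT, hcard, fun i hi => hmem i hi⟩
  have := hAB i₀ (hmem i₀ hi₀)
  rwa [mem_ball, dist_eq_norm] at this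

/-- Propagation of smallness from a set of positive density to a point, at every degree of Taylor
approximation. -/
lemma abs_le_of_small_on_dense_subset (μ : Measure V) [μ.IsAddHaarMeasure] {f : V → ℝ} {x : V}
    {ℓ c M ρ ε : ℝ} (hℓ : 0 < ℓ) (hρ : 0 < ρ) (hM : 0 ≤ M) (hc : 0 < c) (hc1 : c ≤ 1)
    (hf : AnalyticOnNhd ℝ f (ball x ℓ))
    (hb : ∀ y ∈ ball x ℓ, ∀ m : ℕ, ‖iteratedFDeriv ℝ m f y‖ ≤ M * m.factorial / ρ ^ m)
    {F : Set V} (hF : MeasurableSet F) (hFs : F ⊆ ball x (ℓ / 2))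
    (hdens : ENNReal.ofReal c * μ (ball x ℓ) ≤ μ F) (hFε : ∀ y ∈ F, |f y| ≤ ε)
    {k : ℕ} (hk : 1 ≤ k) :
    |f x| ≤ (48 / c) ^ k * (ε + M * k * (ℓ / ρ) ^ k) := by
  set N := ⌈(k : ℝ) / c⌉₊ with hN
  have hk1 : (1 : ℝ) ≤ k := by exact_mod_cast hk
  have hkc : 1 ≤ k / c := by rw [le_div_iff₀ hc]; linarith
  have hN1 : (k : ℝ) / c ≤ N := Nat.le_ceil _
  have hN2 : (N : ℝ) ≤ 2 * k / c := by
    have := (Nat.ceil_lt_add_one (zero_le_one.trans hkc)).le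
    rw [mul_div_assoc]; linarith
  obtain ⟨v, hv, T, hT, hcard, hmem⟩ := exists_segment_grid_mem μ hℓ hF hFs hdens hk
    (N := N) (by rwa [div_le_iff₀ hc] at hN1)
  have hTne : T.Nonempty := Finset.card_pos.1 (by omega)
  set p : Polynomial ℝ := ∑ j ∈ Finset.range k,
    Polynomial.C ((j.factorial : ℝ)⁻¹ * iteratedFDeriv ℝ j f x (fun _ => v)) * Polynomial.X ^ j
    with hp
  have hdeg : p.degree < T.card := by
    rw [hcard, ← Polynomial.mem_degreeLT]
    refine Submodule.sum_mem _ fun j hj => Polynomial.mem_degreeLT.2 ?_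
    exact (Polynomial.degree_C_mul_X_pow_le _ _).trans_lt
      (by exact_mod_cast Finset.mem_range.1 hj)
  have hp0 : p.eval 0 = f x := by
    rw [hp, Polynomial.eval_finsetSum, Finset.sum_eq_single_of_mem 0 (Finset.mem_range.2 hk)]
    · simp
    · intro j _ hj
      simp [hj]
  have hpT : ∀ i ∈ T, |p.eval (1 / 2 + i / (2 * N) : ℝ)| ≤ ε + M * k * (ℓ / ρ) ^ k := by
    intro i hi
    have hiN : (i : ℝ) < N := by exact_mod_cast Finset.mem_range.1 (hT hi)
    set s : ℝ := 1 / 2 + i / (2 * N) with hs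
    have hs0 : 0 ≤ s := by positivity
    have hs1 : s ≤ 1 := by
      have : (i : ℝ) / (2 * N) ≤ 1 / 2 := by
        rw [div_le_iff₀ (by linarith [(Nat.cast_nonneg i : (0 : ℝ) ≤ i)])]; linarith
      linarith
    have hsv : ‖s • v‖ < ℓ := by
      rw [norm_smul, Real.norm_of_nonneg hs0]
      exact (mul_le_of_le_one_left (norm_nonneg v) hs1).trans_lt hv
    have hseg : ∀ t ∈ Set.Icc (0 : ℝ) 1, x + t • s • v ∈ ball x ℓ := by
      intro t ht
      rw [mem_ball, dist_eq_norm, add_sub_cancel_left, norm_smul, Real.norm_of_nonneg ht.1]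
      exact (mul_le_of_le_one_left (norm_nonneg _) ht.2).trans_lt hsv
    have htaylor := abs_sub_taylor_le hk (fun t ht => hf _ (hseg t ht))
      (fun t ht => hb _ (hseg t ht) k)
    have heval : p.eval s = ∑ j ∈ Finset.range k,
        (j.factorial : ℝ)⁻¹ * iteratedFDeriv ℝ j f x (fun _ => s • v) := by
      rw [hp, Polynomial.eval_finsetSum]
      refine Finset.sum_congr rfl fun j _ => ?_
      rw [ContinuousMultilinearMap.map_smul_univ (iteratedFDeriv ℝ j f x) (fun _ => s)
        (fun _ => v)]
      simp
      ring
    rw [← heval] at htaylor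
    have hrem : M * k * (‖s • v‖ / ρ) ^ k ≤ M * k * (ℓ / ρ) ^ k := by gcongr
    have h1 := hFε _ (hmem i hi)
    rw [abs_le] at htaylor h1 ⊢
    constructor <;> linarith [htaylor.1, htaylor.2, h1.1, h1.2]
  have hη : 0 ≤ ε + M * k * (ℓ / ρ) ^ k := by
    obtain ⟨i, hi⟩ := hTne
    exact (abs_nonneg _).trans (hpT i hi)
  have h := abs_eval_zero_le_of_abs_eval_grid_le p N T hT hTne hdeg _ hpT
  rw [hp0, hcard] at h
  exact h.trans (mul_le_mul_of_nonneg_right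
    (extrapolation_const_le c hc hc1 k hk N (Nat.cast_nonneg N) hN2) hη)

/-- One step of Hölder-type propagation of smallness, with an exponent depending only on the
density. -/
lemma exists_exponent_small_of_dense_subset (c : ℝ) (hc : 0 < c) (hc1 : c ≤ 1) :
    ∃ θ ∈ Set.Ioo (0 : ℝ) 1, ∀ (μ : Measure V) [μ.IsAddHaarMeasure] (f : V → ℝ) (x : V)
      (ℓ M ρ h : ℝ) (F : Set V), 0 < ℓ → 0 < ρ → 0 < M → ℓ * (192 / c) ≤ ρ →
      AnalyticOnNhd ℝ f (ball x ℓ) →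
      (∀ y ∈ ball x ℓ, ∀ m : ℕ, ‖iteratedFDeriv ℝ m f y‖ ≤ M * m.factorial / ρ ^ m) →
      MeasurableSet F → F ⊆ ball x (ℓ / 2) → ENNReal.ofReal c * μ (ball x ℓ) ≤ μ F →
      0 ≤ h → (∀ y ∈ F, |f y| / (2 * M) ≤ h) → |f x| / (2 * M) ≤ h ^ θ := by
  have hC : 1 ≤ 48 / c := by rw [le_div_iff₀ hc]; linarith
  obtain ⟨θ, hθ, hb⟩ := exists_rpow_bound_of_geometric_bounds (48 / c) hC
  refine ⟨θ, hθ, ?_⟩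
  intro μ _ f x ℓ M ρ h F hℓ hρ hM hℓρ hf hder hF hFs hdens hh0 hFh
  have h2M : 0 < 2 * M := by linarith
  refine hb _ h ?_ hh0 fun k hk => ?_
  · have := hder x (mem_ball_self hℓ) 0
    rw [norm_iteratedFDeriv_zero, Real.norm_eq_abs] at this
    simp only [Nat.factorial_zero, Nat.cast_one, mul_one, pow_zero, div_one] at this
    rw [div_le_iff₀ h2M]
    linarith
  · have hmain := abs_le_of_small_on_dense_subset μ (ε := 2 * M * h) hℓ hρ hM.le hc hc1 hf hder
      hF hFs hdens (fun y hy => by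
        have := hFh y hy
        rw [div_le_iff₀ h2M] at this; linarith) hk
    have hq : ℓ / ρ * (48 / c) ≤ 1 / 4 := by
      rw [div_mul_eq_mul_div, div_le_iff₀ hρ]
      have : ℓ * (192 / c) = 4 * (ℓ * (48 / c)) := by ring
      linarith
    have hkk : (k : ℝ) ≤ 2 ^ k := by exact_mod_cast (Nat.lt_two_pow_self (n := k)).le
    have hrem : (48 / c) ^ k * (k * (ℓ / ρ) ^ k) ≤ (1 / 2) ^ k := by
      calc (48 / c) ^ k * (k * (ℓ / ρ) ^ k) = k * (ℓ / ρ * (48 / c)) ^ k := by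
            rw [mul_pow]; ring
        _ ≤ 2 ^ k * (1 / 4) ^ k := by gcongr
        _ = (1 / 2) ^ k := by rw [← mul_pow]; norm_num
    rw [div_le_iff₀ h2M]
    nlinarith [mul_le_mul_of_nonneg_left hrem hM.le]

end Extrapolation

section Chain

variable {V : Type*} [NormedAddCommGroup V] [ProperSpace V]

/-- In a preconnected set of bounded diameter, a property that propagates to points at distance
less than `r` reaches the whole set after a number of steps controlled by the diameter and `r`. -/
lemma exists_uniform_propagation_steps (d r : ℝ) (hr : 0 < r) :
    ∃ K : ℕ, ∀ (S : Set V) (G : ℕ → Set V), IsPreconnected S → Bornology.IsBounded S →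
      Metric.diam S ≤ d → (S ∩ G 0).Nonempty →
      (∀ j, ∀ x ∈ S ∩ G j, ∀ y ∈ S, dist y x < r → y ∈ G (j + 1)) → S ⊆ G K := by
  classical
  obtain ⟨t', -, ht'fin, hcov⟩ := (isCompact_closedBall (0 : V) d).finite_cover_balls (half_pos hr)
  lift t' to Finset V using ht'fin with t
  refine ⟨t.card + 1, fun S G hS hbdd hdiam hne hstep => ?_⟩
  obtain ⟨p, hpS, hpG⟩ := hne
  have hcell : ∀ x ∈ S, ∃ c ∈ t, x ∈ ball (p + c) (r / 2) := by
    intro x hx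
    have hx' : x - p ∈ closedBall (0 : V) d := by
      rw [mem_closedBall_zero_iff, ← dist_eq_norm]
      exact (Metric.dist_le_diam_of_mem hbdd hx hpS).trans hdiam
    obtain ⟨c, hc, hxc⟩ := Set.mem_iUnion₂.1 (hcov hx')
    refine ⟨c, hc, ?_⟩
    rw [mem_ball, dist_eq_norm] at hxc ⊢
    rwa [← sub_sub]
  have hmono : ∀ j, S ∩ G j ⊆ G (j + 1) := fun j x hx =>
    hstep j x hx x hx.1 (by rwa [dist_self])
  have hclose : ∀ c x y : V, x ∈ ball (p + c) (r / 2) → y ∈ ball (p + c) (r / 2) →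
      dist y x < r := by
    intro c x y hx hy
    rw [mem_ball] at hx hy
    linarith [dist_triangle_right y x (p + c)]
  set T : ℕ → Finset V := fun j => t.filter fun c => (S ∩ G j ∩ ball (p + c) (r / 2)).Nonempty
    with hT
  have hclaim : ∀ j, S ⊆ G (j + 1) ∨ j + 1 ≤ (T j).card := by
    intro j
    induction j with
    | zero =>
      right
      obtain ⟨c, hc, hpc⟩ := hcell p hpS
      exact Finset.card_pos.2 ⟨c, Finset.mem_filter.2 ⟨hc, p, ⟨hpS, hpG⟩, hpc⟩⟩
    | succ j ih =>
      rcases ih with hsub | hcard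
      · exact Or.inl fun x hx => hmono (j + 1) ⟨hx, hsub hx⟩
      rw [or_iff_not_imp_left]
      intro hnot
      have hTU : ∀ x ∈ S, ∀ c ∈ T j, x ∈ ball (p + c) (r / 2) → x ∈ G (j + 1) := by
        intro x hx c hc hxc
        obtain ⟨-, y, hy, hyc⟩ := Finset.mem_filter.1 hc
        exact hstep j y hy x hx (hclose c y x hyc hxc)
      obtain ⟨z, hzS, hzU, hzV⟩ := hS (⋃ c ∈ T j, ball (p + c) (r / 2))
        (⋃ c ∈ t \ T j, ball (p + c) (r / 2))
        (isOpen_biUnion fun _ _ => isOpen_ball) (isOpen_biUnion fun _ _ => isOpen_ball)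
        (by
          intro x hx
          obtain ⟨c, hc, hxc⟩ := hcell x hx
          by_cases hcT : c ∈ T j
          · exact Or.inl (Set.mem_biUnion hcT hxc)
          · exact Or.inr (Set.mem_biUnion (x := c) (Finset.mem_sdiff.2 ⟨hc, hcT⟩) hxc))
        (by
          obtain ⟨c, hc⟩ := Finset.card_pos.1 (by omega : 0 < (T j).card)
          obtain ⟨-, y, hy, hyc⟩ := Finset.mem_filter.1 hc
          exact ⟨y, hy.1, Set.mem_biUnion hc hyc⟩)
        (by
          obtain ⟨x, hx, hxG⟩ := Set.not_subset.1 hnot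
          obtain ⟨c, hc, hxc⟩ := hcell x hx
          refine ⟨x, hx, Set.mem_biUnion (x := c) (Finset.mem_sdiff.2 ⟨hc, fun hcT => ?_⟩) hxc⟩
          exact hxG (hmono (j + 1) ⟨hx, hTU x hx c hcT hxc⟩))
      obtain ⟨c, hc, hzc⟩ := Set.mem_iUnion₂.1 hzU
      obtain ⟨c', hc', hzc'⟩ := Set.mem_iUnion₂.1 hzV
      obtain ⟨hc't, hc'T⟩ := Finset.mem_sdiff.1 hc'
      have hlt : (T j).card < (T (j + 1)).card := by
        refine Finset.card_lt_card (Finset.ssubset_iff_of_subset ?_ |>.2 ⟨c', ?_, hc'T⟩)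
        · intro b hb
          obtain ⟨hbt, y, hy, hyb⟩ := Finset.mem_filter.1 hb
          exact Finset.mem_filter.2 ⟨hbt, y, ⟨hy.1, hmono j hy⟩, hyb⟩
        · exact Finset.mem_filter.2 ⟨hc't, z, ⟨hzS, hTU z hzS c hc hzc⟩, hzc'⟩
      omega
  refine (hclaim t.card).resolve_right fun h => ?_
  have : (T t.card).card ≤ t.card := Finset.card_filter_le _ _
  omega

end Chain

section Geometry

variable {V : Type*} [NormedAddCommGroup V] [NormedSpace ℝ V] [FiniteDimensional ℝ V]

lemma ball_infDist_frontier_subset {D : Set V} {x : V} (hx : x ∈ D) :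
    ball x (infDist x (frontier D)) ⊆ D := by
  rcases eq_or_ne D Set.univ with rfl | hD
  · exact Set.subset_univ _
  obtain ⟨y, hy, hxy⟩ := exists_mem_frontier_infDist_compl_eq_dist hx hD
  refine (ball_subset_ball ?_).trans ball_infDist_compl_subset
  rw [hxy]
  exact infDist_le_dist_of_mem hy

variable [MeasurableSpace V] [BorelSpace V]

/-- If `E` occupies a fraction `c` of `D` and stays at distance at least `r` from the complement of
`D`, then it occupies a fraction at least `c` of some ball of radius `r` centred in `D`. -/
lemma exists_ball_density_ge (μ : Measure V) [μ.IsAddHaarMeasure] {D E : Set V} {r : ℝ}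
    {c : ENNReal} (hD : IsOpen D) (hDne : D.Nonempty) (hDtop : μ D ≠ ⊤) (hE : MeasurableSet E)
    (hED : E ⊆ D) (hr : ∀ y ∈ E, ball y r ⊆ D) (hdens : c * μ D ≤ μ E) :
    ∃ x ∈ D, c * μ (ball x r) ≤ μ (E ∩ ball x r) := by
  have hD0 : μ D ≠ 0 := (hD.measure_pos μ hDne).ne'
  set P : Set (V × V) := {q | q.2 ∈ E ∧ dist q.2 q.1 < r} with hP
  have hPmeas : MeasurableSet P :=
    (measurable_snd hE).inter
      (isOpen_lt (continuous_snd.dist continuous_fst) continuous_const).measurableSet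
  have hleft : (μ.prod μ) P = ∫⁻ x in D, μ (E ∩ ball x r) ∂μ := by
    have hzero : Function.support (fun x => μ (E ∩ ball x r)) ⊆ D := by
      intro x hx
      obtain ⟨y, hyE, hyx⟩ := nonempty_of_measure_ne_zero hx
      exact hr y hyE (mem_ball_comm.1 hyx)
    rw [Measure.prod_apply hPmeas, setLIntegral_eq_of_support_subset hzero]
    rfl
  have hright : (μ.prod μ) P = μ E * μ (ball (0 : V) r) := by
    rw [Measure.prod_apply_symm hPmeas]
    have h : ∀ y, μ ((fun x => (x, y)) ⁻¹' P) = E.indicator (fun _ => μ (ball (0 : V) r)) y := by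
      intro y
      by_cases hy : y ∈ E
      · rw [Set.indicator_of_mem hy, ← Measure.addHaar_ball_center μ y r]
        congr 1
        ext x
        simp [hP, hy, dist_comm]
      · rw [Set.indicator_of_notMem hy]
        convert measure_empty (μ := μ)
        ext x
        simp [hP, hy]
    simp_rw [h]
    rw [lintegral_indicator hE, setLIntegral_const, mul_comm]
  have hEtop : μ E ≠ ⊤ := ((measure_mono hED).trans_lt hDtop.lt_top).ne
  obtain ⟨x, hxD, hx⟩ := exists_setLAverage_le hD0 hD.measurableSet.nullMeasurableSet
    (f := fun x => μ (E ∩ ball x r))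
    (by rw [← hleft, hright]; exact ENNReal.mul_ne_top hEtop measure_ball_lt_top.ne)
  refine ⟨x, hxD, le_trans ?_ hx⟩
  rw [setLAverage_eq, ← hleft, hright, ENNReal.le_div_iff_mul_le (Or.inl hD0) (Or.inl hDtop),
    Measure.addHaar_ball_center]
  calc c * μ (ball 0 r) * μ D = c * μ D * μ (ball 0 r) := by ring
    _ ≤ _ := by gcongr

end Geometry

/-- **Vessella's stability estimate for analytic continuation.** -/
theorem stmt_6 (n : ℕ) (hn : 1 ≤ n) (τ₀ d₀ ρ δ μ d₁ : ℝ)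
    (hτ₀ : 0 < τ₀) (hd₀ : 0 < d₀) (hρ : 0 < ρ) (hδ : 0 < δ) (hμ : 0 < μ) (hd₁ : 0 < d₁) :
    ∃ θ ∈ Set.Ioo (0 : ℝ) 1,
      ∀ (D E : Set (EuclideanSpace ℝ (Fin n))),
        IsOpen D → Bornology.IsBounded D → IsConnected D → Metric.diam D ≤ d₁ →
        (∀ τ ∈ Set.Icc (0 : ℝ) τ₀,
          IsConnected {x ∈ D | τ < Metric.infDist x (frontier D)}) →
        IsOpen E → E ⊆ D →
        (∀ y ∈ E, d₀ ≤ Metric.infDist y (frontier D)) →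
        ENNReal.ofReal μ * volume D ≤ volume E →
        ∀ (M : ℝ), 0 < M →
        ∀ (f : EuclideanSpace ℝ (Fin n) → ℝ),
          AnalyticOnNhd ℝ f D →
          (∀ x ∈ D, ∀ m : ℕ, ‖iteratedFDeriv ℝ m f x‖ ≤ M * m.factorial / ρ ^ m) →
          ∀ x ∈ D, δ ≤ Metric.infDist x (frontier D) →
            |f x| ≤ (2 * M) ^ (1 - θ) * (sSup ((fun y => |f y|) '' E)) ^ θ := by
  set V := EuclideanSpace ℝ (Fin n) with hV
  set τ := min τ₀ (min (d₀ / 2) (δ / 2)) with hτ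
  have hτpos : 0 < τ := by positivity
  have hττ₀ : τ ≤ τ₀ := min_le_left _ _
  have hτd₀ : τ ≤ d₀ / 2 := (min_le_right _ _).trans (min_le_left _ _)
  have hτδ : τ ≤ δ / 2 := (min_le_right _ _).trans (min_le_right _ _)
  set c := min μ 1 / 6 ^ n with hc
  have hcpos : 0 < c := by positivity
  have hc1 : c ≤ 1 := by
    rw [hc, div_le_one (by positivity)]
    exact (min_le_right _ _).trans (one_le_pow₀ (by norm_num))
  have hcμ : c * 6 ^ n ≤ μ := by
    rw [hc, div_mul_cancel₀ _ (by positivity)]; exact min_le_left _ _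
  have hc1' : c * 6 ^ n ≤ 1 := by
    rw [hc, div_mul_cancel₀ _ (by positivity)]; exact min_le_right _ _
  obtain ⟨θ₁, ⟨hθ₁0, hθ₁1⟩, hstep⟩ := exists_exponent_small_of_dense_subset (V := V) c hcpos hc1
  set r := min (τ / 7) (ρ / (6 * (192 / c))) with hr
  have hrpos : 0 < r := by positivity
  have hrτ : r ≤ τ / 7 := min_le_left _ _
  have hrρ : 6 * r * (192 / c) ≤ ρ := by
    have h : r ≤ ρ / (6 * (192 / c)) := min_le_right _ _
    rw [le_div_iff₀ (by positivity)] at h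
    linarith
  obtain ⟨K, hK⟩ := exists_uniform_propagation_steps (V := V) d₁ r hrpos
  refine ⟨θ₁ ^ (K + 1), ⟨by positivity, pow_lt_one₀ hθ₁0.le hθ₁1 (by omega)⟩, ?_⟩
  intro D E hD hDbdd hDconn hdiam hconn hE hED hEd hvol M hM f hf hder x hx hxδ
  have h2M : 0 < 2 * M := by linarith
  have hfM : ∀ y ∈ D, |f y| ≤ M := fun y hy => by simpa using hder y hy 0
  have hbddE : BddAbove ((fun y => |f y|) '' E) :=
    ⟨M, by rintro _ ⟨y, hy, rfl⟩; exact hfM y (hED hy)⟩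
  set ε := sSup ((fun y => |f y|) '' E) with hε
  have hε0 : 0 ≤ ε := Real.sSup_nonneg (by rintro _ ⟨y, -, rfl⟩; exact abs_nonneg _)
  set h := ε / (2 * M) with hh
  have hh0 : 0 ≤ h := by positivity
  have hballvol : ∀ y z : V, ENNReal.ofReal c * volume (ball y (6 * r)) =
      ENNReal.ofReal (c * 6 ^ n) * volume (ball z r) := by
    intro y z
    rw [Measure.addHaar_ball_mul_of_pos volume y (by norm_num : (0 : ℝ) < 6) r,
      Measure.addHaar_ball_center volume z r, finrank_euclideanSpace_fin, ← mul_assoc,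
      ENNReal.ofReal_mul hcpos.le]
  have hone : ∀ (h' : ℝ) (y z : V) (F : Set V), y ∈ D →
      τ < infDist y (frontier D) → dist z y < r → IsOpen F → F ⊆ ball y (2 * r) →
      ENNReal.ofReal (c * 6 ^ n) * volume (ball y r) ≤ volume F → 0 ≤ h' →
      (∀ w ∈ F, |f w| / (2 * M) ≤ h') → |f z| / (2 * M) ≤ h' ^ θ₁ := by
    intro h' y z F hy hyτ hzy hF hFs hFvol hh' hFh
    have hsub : ball z (6 * r) ⊆ D := by
      refine (ball_subset_ball' ?_).trans (ball_infDist_frontier_subset hy)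
      linarith
    refine hstep volume f z (6 * r) M ρ h' F (by positivity) hρ hM hrρ
      (hf.mono hsub) (fun w hw => hder w (hsub hw)) hF.measurableSet
      (hFs.trans (ball_subset_ball' ?_)) ?_ hh' hFh
    · rw [dist_comm]; linarith
    · rwa [hballvol z y]
  set S := {y ∈ D | τ < infDist y (frontier D)} with hS
  set G : ℕ → Set V := fun j => {y | ∀ z ∈ ball y r, |f z| / (2 * M) ≤ h ^ (θ₁ ^ (j + 1))} with hG
  have hstart : (S ∩ G 0).Nonempty := by
    obtain ⟨x₀, hx₀D, hx₀⟩ := exists_ball_density_ge volume hD hDconn.nonempty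
      hDbdd.measure_lt_top.ne hE.measurableSet hED (r := r)
      (fun y hy => (ball_subset_ball (by linarith [hEd y hy])).trans
        (ball_infDist_frontier_subset (hED hy))) hvol
    have hpos : volume (E ∩ ball x₀ r) ≠ 0 := by
      refine (lt_of_lt_of_le ?_ hx₀).ne'
      exact ENNReal.mul_pos (ENNReal.ofReal_pos.2 hμ).ne' (measure_ball_pos volume x₀ hrpos).ne'
    obtain ⟨y, hyE, hyx₀⟩ := nonempty_of_measure_ne_zero hpos
    have hx₀τ : τ < infDist x₀ (frontier D) := by
      have h1 := infDist_le_infDist_add_dist (s := frontier D) (x := y) (y := x₀)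
      rw [mem_ball] at hyx₀
      linarith [hEd y hyE]
    refine ⟨x₀, ⟨hx₀D, hx₀τ⟩, fun z hz => ?_⟩
    rw [zero_add, pow_one]
    refine hone h x₀ z (E ∩ ball x₀ r) hx₀D hx₀τ hz (hE.inter isOpen_ball)
      (Set.inter_subset_right.trans (ball_subset_ball (by linarith))) ?_ hh0 ?_
    · refine le_trans ?_ hx₀
      gcongr
    · intro w hw
      exact div_le_div_of_nonneg_right (le_csSup hbddE ⟨w, hw.1, rfl⟩) h2M.le
  have hprop : ∀ j, ∀ y ∈ S ∩ G j, ∀ z ∈ S, dist z y < r → z ∈ G (j + 1) := by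
    intro j y hy z hz hzy w hw
    rw [pow_succ, Real.rpow_mul hh0]
    refine hone _ z w (ball y r) hz.1 hz.2 hw isOpen_ball (ball_subset_ball' ?_) ?_
      (Real.rpow_nonneg hh0 _) hy.2
    · rw [dist_comm]; linarith
    · rw [Measure.addHaar_ball_center volume y r, Measure.addHaar_ball_center volume z r]
      refine mul_le_of_le_one_left' ?_
      rwa [ENNReal.ofReal_le_one]
  have hxS : x ∈ S := ⟨hx, by linarith⟩
  have hfinal := hK S G (hconn τ ⟨hτpos.le, hττ₀⟩).isPreconnected
    (hDbdd.subset (Set.sep_subset _ _)) ((diam_mono (Set.sep_subset _ _) hDbdd).trans hdiam)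
    hstart hprop hxS x (mem_ball_self hrpos)
  rw [div_le_iff₀ h2M, hh, Real.div_rpow hε0 h2M.le] at hfinal
  rw [Real.rpow_sub h2M, Real.rpow_one]
  exact hfinal.trans_eq (by ring)
end

section
/- Let n ≥ 1 and let E be a nonempty open subset of the open unit ball B(0,1) ⊂ ℝⁿ. There exist θ ∈ (0,1) and c > 0, depending only on n and E, such that for every r > 0, every integrable q : ℝⁿ → ℂ with support contained in the closed ball of radius r centered at the origin, every R > 0 and every k ∈ ℝⁿ with ‖k‖ ≤ R, one has |𝓕q(k)| ≤ (2 ‖q‖_{L¹(ℝⁿ)} e^{c r R})^{1−θ} · (sup_{e ∈ E} |𝓕q(R e)|)^{θ}. -/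
open MeasureTheory Real
open scoped FourierTransform

open Complex.HadamardThreeLines in
/-- Two-constants estimate: an entire function of exponential type in the imaginary direction
which is small on `[-δ, δ]` is controlled at `1`. The strip `0 ≤ re w ≤ 2 * a` is mapped by
`w ↦ δ * cosh w` onto a filled ellipse, the line `re w = 0` being sent to `[-δ, δ]`. -/
theorem norm_apply_one_le_of_norm_le_exp_abs_im {g : ℂ → ℂ} (hg : Differentiable ℂ g)
    {K A m δ a : ℝ} (hK : 0 ≤ K) (hA : 0 ≤ A) (hδ : 0 < δ) (ha : 0 < a)
    (hδa : δ * Real.cosh a = 1)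
    (hgK : ∀ z : ℂ, ‖g z‖ ≤ K * Real.exp (A * |z.im|))
    (hgm : ∀ t : ℝ, |t| ≤ δ → ‖g t‖ ≤ m) :
    ‖g 1‖ ≤ m ^ (1 / 2 : ℝ) * (K * Real.exp (A * (δ * Real.sinh (2 * a)))) ^ (1 / 2 : ℝ) := by
  have him : ∀ w : ℂ, ((δ : ℂ) * Complex.cosh w).im = δ * (Real.sinh w.re * Real.sin w.im) := by
    intro w
    conv_lhs => rw [← Complex.re_add_im w]
    rw [Complex.cosh_add, Complex.cosh_mul_I, Complex.sinh_mul_I]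
    simp only [← Complex.ofReal_cosh, ← Complex.ofReal_sinh, ← Complex.ofReal_cos,
      ← Complex.ofReal_sin]
    simp [-Complex.ofReal_cosh, -Complex.ofReal_sinh, -Complex.ofReal_cos, -Complex.ofReal_sin]
  have hbound : ∀ w ∈ verticalClosedStrip 0 (2 * a),
      ‖g (δ * Complex.cosh w)‖ ≤ K * Real.exp (A * (δ * Real.sinh (2 * a))) := by
    intro w hw
    refine (hgK _).trans ?_
    gcongr
    rw [him, abs_mul, abs_of_pos hδ, abs_mul, abs_of_nonneg (Real.sinh_nonneg_iff.2 hw.1)]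
    gcongr
    calc Real.sinh w.re * |Real.sin w.im| ≤ Real.sinh w.re * 1 := by
          gcongr
          · exact Real.sinh_nonneg_iff.2 hw.1
          · exact Real.abs_sin_le_one _
      _ ≤ Real.sinh (2 * a) := by
          rw [mul_one]
          exact Real.sinh_le_sinh.2 hw.2
  have h2a : 0 < 2 * a := by positivity
  have hdiff : Differentiable ℂ fun w => g (δ * Complex.cosh w) :=
    hg.comp (Complex.differentiable_cosh.const_mul _)
  have key := norm_le_interp_of_mem_verticalClosedStrip' (f := fun w => g (δ * Complex.cosh w))
    (z := a) (a := m) (b := K * Real.exp (A * (δ * Real.sinh (2 * a)))) h2a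
    ⟨by simpa using ha.le, by simpa using by linarith⟩ hdiff.diffContOnCl
    ⟨_, by rintro _ ⟨w, hw, rfl⟩; exact hbound w hw⟩
    (fun w hw => by
      have hre : w.re = 0 := hw
      have hw' : (δ : ℂ) * Complex.cosh w = ((δ * Real.cos w.im : ℝ) : ℂ) := by
        conv_lhs => rw [← Complex.re_add_im w, hre]
        simp [Complex.cosh_mul_I]
      simp only [hw']
      refine hgm _ ?_
      rw [abs_mul, abs_of_pos hδ]
      exact mul_le_of_le_one_right hδ.le (Real.abs_cos_le_one _))
    (fun w hw => hbound w ⟨by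
      have : w.re = 2 * a := hw
      simp [this, ha.le], le_of_eq hw⟩)
  have h1 : (δ : ℂ) * Complex.cosh a = 1 := by
    rw [← Complex.ofReal_cosh, ← Complex.ofReal_mul, hδa, Complex.ofReal_one]
  have h2 : (a - 0) / (2 * a - 0) = 1 / 2 := by field_simp; simp
  have h3 : (1 : ℝ) - 1 / 2 = 1 / 2 := by norm_num
  simpa only [Complex.ofReal_re, h1, h2, h3] using key

theorem norm_cexp_ofReal_mul_I_mul (b : ℝ) (z : ℂ) :
    ‖Complex.exp (b * z * Complex.I)‖ = Real.exp (-(b * z.im)) := by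
  rw [Complex.norm_exp]
  simp

section OscillatoryIntegral

variable {α : Type*} {p : α → ℂ} {b : α → ℝ} {B : ℝ}

theorem norm_cexp_mul_le_of_support (hbB : ∀ x ∈ Function.support p, |b x| ≤ B) (z : ℂ) (x : α) :
    ‖Complex.exp (b x * z * Complex.I) * p x‖ ≤ Real.exp (B * |z.im|) * ‖p x‖ := by
  by_cases hx : p x = 0
  · simp [hx]
  rw [norm_mul, norm_cexp_ofReal_mul_I_mul]
  gcongr
  calc -(b x * z.im) ≤ |b x| * |z.im| := by rw [← abs_mul]; exact neg_le_abs _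
    _ ≤ B * |z.im| := by gcongr; exact hbB x hx

variable [MeasurableSpace α] {μ : Measure α}

theorem integrable_cexp_mul (hp : Integrable p μ) (hb : Measurable b)
    (hbB : ∀ x ∈ Function.support p, |b x| ≤ B) (z : ℂ) :
    Integrable (fun x => Complex.exp (b x * z * Complex.I) * p x) μ :=
  (hp.norm.const_mul (Real.exp (B * |z.im|))).mono'
    ((by fun_prop : Measurable fun x => Complex.exp (b x * z * Complex.I)).aestronglyMeasurable.mul
      hp.aestronglyMeasurable)
    (.of_forall fun x => norm_cexp_mul_le_of_support hbB z x)

theorem norm_integral_cexp_mul_le (hp : Integrable p μ)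
    (hbB : ∀ x ∈ Function.support p, |b x| ≤ B) (z : ℂ) :
    ‖∫ x, Complex.exp (b x * z * Complex.I) * p x ∂μ‖ ≤
      (∫ x, ‖p x‖ ∂μ) * Real.exp (B * |z.im|) := by
  rw [mul_comm, ← integral_const_mul]
  exact norm_integral_le_of_norm_le (hp.norm.const_mul _)
    (.of_forall fun x => norm_cexp_mul_le_of_support hbB z x)

theorem differentiable_integral_cexp_mul (hp : Integrable p μ) (hb : Measurable b)
    (hB : 0 ≤ B) (hbB : ∀ x ∈ Function.support p, |b x| ≤ B) :
    Differentiable ℂ fun z : ℂ => ∫ x, Complex.exp (b x * z * Complex.I) * p x ∂μ := by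
  intro z₀
  refine (hasDerivAt_integral_of_dominated_loc_of_deriv_le
    (F := fun z x => Complex.exp (b x * z * Complex.I) * p x)
    (F' := fun z x => (b x * Complex.I) * (Complex.exp (b x * z * Complex.I) * p x))
    (bound := fun x => B * (Real.exp (B * (‖z₀‖ + 1)) * ‖p x‖))
    (Metric.ball_mem_nhds z₀ one_pos)
    (.of_forall fun z => (integrable_cexp_mul hp hb hbB z).aestronglyMeasurable)
    (integrable_cexp_mul hp hb hbB z₀)
    ((by fun_prop : Measurable fun x => (b x * Complex.I : ℂ)).aestronglyMeasurable.mul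
      (integrable_cexp_mul hp hb hbB z₀).aestronglyMeasurable)
    (.of_forall fun x z hz => ?_) ((hp.norm.const_mul _).const_mul _)
    (.of_forall fun x z _ => ?_)).2.differentiableAt
  · by_cases hx : p x = 0
    · simp [hx]
    have hz' : |z.im| ≤ ‖z₀‖ + 1 := by
      have h1 := Complex.abs_im_le_norm z
      have h2 := norm_le_norm_add_norm_sub' z z₀
      have h3 : ‖z - z₀‖ < 1 := mem_ball_iff_norm.1 hz
      linarith
    rw [norm_mul]
    refine mul_le_mul (by simpa using hbB x hx) ((norm_cexp_mul_le_of_support hbB z x).trans ?_)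
      (norm_nonneg _) hB
    gcongr
  · have h : HasDerivAt (fun z : ℂ => (b x : ℂ) * z * Complex.I) ((b x : ℂ) * 1 * Complex.I) z :=
      ((hasDerivAt_id z).const_mul (b x : ℂ)).mul_const _
    exact (h.cexp.mul_const (p x)).congr_deriv (by ring)

end OscillatoryIntegral

theorem norm_fourier_le_integral_norm {V : Type*} [NormedAddCommGroup V] [InnerProductSpace ℝ V]
    [MeasurableSpace V] [BorelSpace V] [FiniteDimensional ℝ V] (q : V → ℂ) (w : V) :
    ‖𝓕 q w‖ ≤ ∫ x, ‖q x‖ :=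
  VectorFourier.norm_fourierIntegral_le_integral_norm _ _ _ _ _

/-- The Fourier transform of a compactly supported function, restricted to the line through `u`
with direction `v`, extends to an entire function of exponential type. -/
theorem exists_entire_extension_fourier_line {V : Type*} [NormedAddCommGroup V]
    [InnerProductSpace ℝ V] [MeasurableSpace V] [BorelSpace V] [FiniteDimensional ℝ V]
    {q : V → ℂ} (hq : Integrable q) {r : ℝ} (hr : 0 ≤ r)
    (hsupp : Function.support q ⊆ Metric.closedBall 0 r) (u v : V) :
    ∃ g : ℂ → ℂ, Differentiable ℂ g ∧
      (∀ z : ℂ, ‖g z‖ ≤ (∫ x, ‖q x‖) * Real.exp (2 * π * r * ‖v‖ * |z.im|)) ∧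
      ∀ t : ℝ, g t = 𝓕 q (u + t • v) := by
  set p : V → ℂ := fun x => Complex.exp (↑(-2 * π * inner ℝ x u) * Complex.I) * q x with hp_def
  have hp_norm : ∀ x, ‖p x‖ = ‖q x‖ := fun x => by
    rw [hp_def, norm_mul, Complex.norm_exp_ofReal_mul_I, one_mul]
  have hp : Integrable p := by
    refine hq.mono (AEStronglyMeasurable.mul ?_ hq.aestronglyMeasurable)
      (.of_forall fun x => (hp_norm x).le)
    exact Continuous.aestronglyMeasurable (by fun_prop)
  have hbB : ∀ x ∈ Function.support p, |-2 * π * inner ℝ x v| ≤ 2 * π * r * ‖v‖ := by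
    intro x hx
    have hxq : x ∈ Function.support q := by
      rw [Function.mem_support, ← norm_ne_zero_iff, ← hp_norm, norm_ne_zero_iff]
      exact hx
    have hxr : ‖x‖ ≤ r := by simpa using hsupp hxq
    calc |-2 * π * inner ℝ x v| = 2 * π * |inner ℝ x v| := by
          rw [abs_mul, abs_mul, abs_neg, abs_of_pos Real.pi_pos, abs_two]
      _ ≤ 2 * π * (r * ‖v‖) := by
          gcongr
          exact (abs_real_inner_le_norm x v).trans (by gcongr)
      _ = 2 * π * r * ‖v‖ := by ring
  have hb : Measurable fun x : V => -2 * π * inner ℝ x v :=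
    Continuous.measurable (by fun_prop)
  refine ⟨_, differentiable_integral_cexp_mul hp hb (by positivity) hbB, fun z => ?_, fun t => ?_⟩
  · simpa only [hp_norm] using norm_integral_cexp_mul_le hp hbB z
  · rw [Real.fourier_eq']
    refine integral_congr_ae (.of_forall fun x => ?_)
    simp only [hp_def, smul_eq_mul]
    rw [← mul_assoc, ← Complex.exp_add, inner_add_right, inner_smul_right]
    congr 2
    push_cast
    ring



/-- Quantitative analytic continuation of the Fourier transform of a compactly supported
integrable function from a fixed nonempty open subset `E` of the unit ball. -/
theorem stmt_9 (n : ℕ) (hn : 1 ≤ n) (E : Set (EuclideanSpace ℝ (Fin n)))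
    (hE_open : IsOpen E) (hE_ne : E.Nonempty) (hE_sub : E ⊆ Metric.ball 0 1) :
    ∃ θ ∈ Set.Ioo (0 : ℝ) 1, ∃ c > (0 : ℝ),
      ∀ (r : ℝ), 0 < r →
      ∀ (q : EuclideanSpace ℝ (Fin n) → ℂ),
        Integrable q →
        Function.support q ⊆ Metric.closedBall 0 r →
        ∀ (R : ℝ), 0 < R →
        ∀ (k : EuclideanSpace ℝ (Fin n)), ‖k‖ ≤ R →
          ‖𝓕 q k‖ ≤ (2 * (∫ x, ‖q x‖) * Real.exp (c * r * R)) ^ (1 - θ) *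
            (sSup ((fun e => ‖𝓕 q (R • e)‖) '' E)) ^ θ := by
  obtain ⟨x₀, hx₀⟩ := hE_ne
  obtain ⟨ρ, hρ, hball⟩ := Metric.isOpen_iff.1 hE_open x₀ hx₀
  obtain ⟨δ, hδ, hδ1, hδρ⟩ : ∃ δ : ℝ, 0 < δ ∧ δ < 1 ∧ δ * 2 < ρ :=
    ⟨min (1 / 2) (ρ / 3), by positivity, (min_le_left _ _).trans_lt (by norm_num), by
      have := min_le_right (1 / 2) (ρ / 3)
      linarith⟩
  have hδ_inv : 1 < δ⁻¹ := (one_lt_inv₀ hδ).2 hδ1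
  set a := Real.arcosh δ⁻¹ with ha_def
  have ha : 0 < a := Real.arcosh_pos hδ_inv
  have hδa : δ * Real.cosh a = 1 := by
    rw [ha_def, Real.cosh_arcosh hδ_inv.le, mul_inv_cancel₀ hδ.ne']
  refine ⟨1 / 2, by norm_num, 2 * π * 2 * (δ * Real.sinh (2 * a)), ?_, ?_⟩
  · have : 0 < Real.sinh (2 * a) := Real.sinh_pos_iff.2 (by positivity)
    positivity
  intro r hr q hq hsupp R hR k hk
  have hx₀1 : ‖x₀‖ < 1 := by simpa using hE_sub hx₀
  set v := k - R • x₀ with hv_def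
  have hv : ‖v‖ ≤ 2 * R := by
    have h := norm_sub_le k (R • x₀)
    rw [norm_smul, Real.norm_of_nonneg hR.le] at h
    nlinarith
  have hK : 0 ≤ ∫ x, ‖q x‖ := integral_nonneg fun _ => norm_nonneg _
  have hbdd : BddAbove ((fun e => ‖𝓕 q (R • e)‖) '' E) :=
    ⟨∫ x, ‖q x‖, by rintro _ ⟨e, -, rfl⟩; exact norm_fourier_le_integral_norm q _⟩
  obtain ⟨g, hg, hgK, hgt⟩ := exists_entire_extension_fourier_line hq hr.le hsupp (R • x₀) v
  have hgm : ∀ t : ℝ, |t| ≤ δ → ‖g t‖ ≤ sSup ((fun e => ‖𝓕 q (R • e)‖) '' E) := by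
    intro t ht
    have hmem : x₀ + (t * R⁻¹) • v ∈ E := by
      apply hball
      rw [mem_ball_iff_norm, add_sub_cancel_left, norm_smul, norm_mul, norm_inv,
        Real.norm_of_nonneg hR.le, Real.norm_eq_abs]
      calc |t| * R⁻¹ * ‖v‖ ≤ δ * R⁻¹ * (2 * R) := by gcongr
        _ = δ * 2 := by field_simp
        _ < ρ := hδρ
    have hpt : R • x₀ + t • v = R • (x₀ + (t * R⁻¹) • v) := by
      rw [smul_add, smul_smul, mul_left_comm, mul_inv_cancel₀ hR.ne', mul_one]
    rw [hgt, hpt]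
    exact le_csSup hbdd ⟨_, hmem, rfl⟩
  have hg1 : 𝓕 q k = g 1 := by
    have := hgt 1
    rw [Complex.ofReal_one, one_smul, hv_def, add_sub_cancel] at this
    exact this.symm
  have hm : 0 ≤ sSup ((fun e => ‖𝓕 q (R • e)‖) '' E) :=
    Real.sSup_nonneg (by rintro _ ⟨e, -, rfl⟩; exact norm_nonneg _)
  rw [hg1]
  refine (norm_apply_one_le_of_norm_le_exp_abs_im hg hK (A := 2 * π * r * ‖v‖) (by positivity)
    hδ ha hδa hgK hgm).trans ?_
  rw [mul_comm, show (1 : ℝ) - 1 / 2 = 1 / 2 by norm_num]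
  have hsinh : 0 ≤ Real.sinh (2 * a) := Real.sinh_nonneg_iff.2 (by positivity)
  have hexp : 2 * π * r * ‖v‖ * (δ * Real.sinh (2 * a)) ≤
      2 * π * 2 * (δ * Real.sinh (2 * a)) * r * R :=
    calc 2 * π * r * ‖v‖ * (δ * Real.sinh (2 * a))
        ≤ 2 * π * r * (2 * R) * (δ * Real.sinh (2 * a)) := by gcongr
      _ = 2 * π * 2 * (δ * Real.sinh (2 * a)) * r * R := by ring
  refine mul_le_mul_of_nonneg_right (Real.rpow_le_rpow (by positivity) ?_ (by norm_num))
    (Real.rpow_nonneg hm _)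
  exact mul_le_mul (by linarith) (Real.exp_le_exp.2 hexp) (Real.exp_nonneg _) (by positivity)
end
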